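/- Let A=(Q,Σ,δ,ρ) be a connected bireversible Mealy automaton whose orbit tree o(A) has no active self-liftable branch, and let j be a jungle tree of o(A) with trunk of length n. (Ubiquity.) For all words t,u,v∈Q* such that t·u·v is a j-word, there exists w∈Q* such that t·u·v·w·u is a j-word. -/

import Mathlib

open List

variable {Q A : Type*}

/-- Action of a state on words over the alphabet:
`ρ_x(i·s) = ρ_x(i) · ρ_{δ_i(x)}(s)`. -/
def mrho (d : A → Q → Q) (r : Q → A → A) : Q → List A → List A
  | _, [] => []
  | x, i :: s => r x i :: mrho d r (d i x) s

/-- Action of a word of states: `ρ_{x₁⋯x_m} = ρ_{x_m} ∘ ⋯ ∘ ρ_{x₁}`. -/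
def mrhoW (d : A → Q → Q) (r : Q → A → A) : List Q → List A → List A
  | [], s => s
  | x :: u, s => mrhoW d r u (mrho d r x s)

/-- Dual action of a letter on words of states:
`δ_i(x·u) = δ_i(x) · δ_{ρ_x(i)}(u)`. -/
def mdel (d : A → Q → Q) (r : Q → A → A) : A → List Q → List Q
  | _, [] => []
  | i, x :: u => d i x :: mdel d r (r x i) u

/-- Action of a word of letters: `δ_{s₁⋯s_m} = δ_{s_m} ∘ ⋯ ∘ δ_{s₁}`. -/
def mdelW (d : A → Q → Q) (r : Q → A → A) : List A → List Q → List Q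
  | [], u => u
  | i :: s, u => mdelW d r s (mdel d r i u)

/-- Connected component (orbit under the dual action) of a word of states. -/
def mOrbit (d : A → Q → Q) (r : Q → A → A) (u : List Q) : Set (List Q) :=
  { v | ∃ s : List A, mdelW d r s u = v }

/-- The Mealy automaton is invertible. -/
def MInvertible (r : Q → A → A) : Prop := ∀ x : Q, Function.Bijective (r x)

/-- The Mealy automaton is reversible. -/
def MReversible (d : A → Q → Q) : Prop := ∀ i : A, Function.Bijective (d i)

/-- The Mealy automaton is connected. -/
def MConnected (d : A → Q → Q) (r : Q → A → A) : Prop :=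
  ∀ x y : Q, ∃ s : List A, mdelW d r s [x] = [y]

/-- The Mealy automaton is bireversible: invertible, reversible, and for each output
letter `j`, the map sending `x` to `δ_i(x)` (where `i` is the unique letter with
`ρ_x(i) = j`) is a permutation of the (finite) stateset, encoded as injectivity. -/
def MBireversible (d : A → Q → Q) (r : Q → A → A) : Prop :=
  MInvertible r ∧ MReversible d ∧
    ∀ (x y : Q) (i i' : A), r x i = r y i' → d i x = d i' y → x = y

/-- The edge of the orbit tree whose bottom is the component of `e` is liftable
to the edge whose bottom is the component of `f`: every word of `⊥(e)` admits
some word of `⊥(f)` as a suffix. -/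
def EdgeLiftable (d : A → Q → Q) (r : Q → A → A) (e f : List Q) : Prop :=
  ∀ v ∈ mOrbit d r e, ∃ v' ∈ mOrbit d r f, v' <:+ v

/-- Prefix of length `m` of the infinite word `α : ℕ → Q`. -/
def branchPrefix (α : ℕ → Q) (m : ℕ) : List Q := (List.range m).map α

/-- The orbit tree admits an active self-liftable branch: a branch, represented by
an infinite word `α`, which is `k`-self-liftable for some `k ≥ 1` (every edge at
level `j + k` of the branch is liftable to the edge at level `j`), and active
(its label sequence is not eventually `1`, i.e. the sizes of the components of the
prefixes do not become eventually constant). -/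
def HasActiveSelfLiftableBranch (d : A → Q → Q) (r : Q → A → A) : Prop :=
  ∃ (α : ℕ → Q) (k : ℕ), 1 ≤ k ∧
    (∀ j : ℕ, 1 ≤ j → EdgeLiftable d r (branchPrefix α (j + k)) (branchPrefix α j)) ∧
    ∀ N : ℕ, ∃ m : ℕ, N ≤ m ∧
      (mOrbit d r (branchPrefix α (m + 1))).ncard ≠ (mOrbit d r (branchPrefix α m)).ncard

/-- `t` represents the trunk of a jungle tree: a non-empty finite initial
`1`-self-liftable path (each edge of the trunk is liftable to the preceding one)
such that the bottom of the trunk has at least two legitimate children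
(children liftable to the last trunk edge), and every legitimate child has label `1`. -/
def IsJungleTrunk (d : A → Q → Q) (r : Q → A → A) (t : List Q) : Prop :=
  t ≠ [] ∧
  (∀ j : ℕ, 2 ≤ j → j ≤ t.length → EdgeLiftable d r (t.take j) (t.take (j - 1))) ∧
  (∃ x y : Q, mOrbit d r (t ++ [x]) ≠ mOrbit d r (t ++ [y]) ∧
    EdgeLiftable d r (t ++ [x]) t ∧ EdgeLiftable d r (t ++ [y]) t) ∧
  ∀ x : Q, EdgeLiftable d r (t ++ [x]) t →
    (mOrbit d r (t ++ [x])).ncard = (mOrbit d r t).ncard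

/-- `u` is a `j`-word for the jungle tree with trunk `t`: the sequence of connected
components of the prefixes of `u` is an initial path of the jungle tree, i.e. the
component of each prefix of length `i ≤ |t|` coincides with the component of the
corresponding trunk prefix, and each deeper edge is liftable to the last trunk edge. -/
def IsJWord (d : A → Q → Q) (r : Q → A → A) (t u : List Q) : Prop :=
  (∀ i : ℕ, i ≤ u.length → i ≤ t.length → u.take i ∈ mOrbit d r (t.take i)) ∧
  ∀ l : ℕ, t.length ≤ l → l < u.length → EdgeLiftable d r (u.take (l + 1)) t

/-- A stem is a `j`-word whose length is the length of the trunk. -/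
def IsStem (d : A → Q → Q) (r : Q → A → A) (t u : List Q) : Prop :=
  IsJWord d r t u ∧ u.length = t.length

/-- A cyclic `j`-word is a finite word all of whose powers are `j`-words. -/
def IsCyclicJWord (d : A → Q → Q) (r : Q → A → A) (t u : List Q) : Prop :=
  ∀ k : ℕ, IsJWord d r t (List.flatten (List.replicate k u))

/-- The relation `∼` on stems: `u ∼ v` whenever there is `s` such that `u·s·v` is a
`j`-word and `ρ_{u·s}` acts like the identity on `Σ*`. -/
def StemEquiv (d : A → Q → Q) (r : Q → A → A) (t u v : List Q) : Prop :=
  ∃ s : List Q, IsJWord d r t (u ++ s ++ v) ∧ ∀ w : List A, mrhoW d r (u ++ s) w = w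

theorem aux_period {α : Type*} (S : Set α) (hS : S.Finite) (f : α → α)
    (hm : Set.MapsTo f S S) (hi : Set.InjOn f S) (x : α) (hx : x ∈ S) :
    ∃ m : ℕ, f^[m] (f x) = x := by
  have hmS : ∀ m : ℕ, ∀ y ∈ S, f^[m] y ∈ S := by
    intro m
    induction m with
    | zero => intro y hy; simpa using hy
    | succ k ih => intro y hy; rw [Function.iterate_succ_apply]; exact ih _ (hm hy)
  have hinj : ∀ m : ℕ, ∀ y ∈ S, ∀ z ∈ S, f^[m] y = f^[m] z → y = z := by
    intro m
    induction m with
    | zero => intro y _ z _ h; simpa using h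
    | succ k ih =>
      intro y hy z hz h
      rw [Function.iterate_succ_apply, Function.iterate_succ_apply] at h
      exact hi hy hz (ih _ (hm hy) _ (hm hz) h)
  haveI := hS.to_subtype
  obtain ⟨a, b, hab, he⟩ := Finite.exists_ne_map_eq_of_infinite
    (fun m : ℕ => (⟨f^[m] x, hmS m x hx⟩ : S))
  have key : ∀ a b : ℕ, a < b → f^[a] x = f^[b] x → ∃ m : ℕ, f^[m] (f x) = x := by
    intro a b hlt he
    obtain ⟨c, rfl⟩ := Nat.exists_eq_add_of_lt hlt
    refine ⟨c, ?_⟩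
    rw [← Function.iterate_succ_apply]
    have : a + c + 1 = a + (c + 1) := by omega
    rw [this, Function.iterate_add_apply] at he
    exact (hinj a _ hx _ (hmS _ x hx) he).symm
  have he' : f^[a] x = f^[b] x := congrArg Subtype.val he
  rcases lt_or_gt_of_ne hab with h | h
  · exact key a b h he'
  · exact key b a h he'.symm

section
variable {Q A : Type*} (d : A → Q → Q) (r : Q → A → A)

theorem mdel_len (i : A) (u : List Q) : (mdel d r i u).length = u.length := by
  induction u generalizing i with
  | nil => rfl
  | cons x u ih => simp [mdel, ih]

theorem mdelW_len (s : List A) (u : List Q) : (mdelW d r s u).length = u.length := by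
  induction s generalizing u with
  | nil => rfl
  | cons i s ih => simp [mdelW, ih, mdel_len]

theorem mdelW_app (s s' : List A) (u : List Q) :
    mdelW d r (s ++ s') u = mdelW d r s' (mdelW d r s u) := by
  induction s generalizing u with
  | nil => rfl
  | cons i s ih => simp [mdelW, ih]

theorem mdel_split (p q : List Q) (i : A) :
    ∃ i', mdel d r i (p ++ q) = mdel d r i p ++ mdel d r i' q := by
  induction p generalizing i with
  | nil => exact ⟨i, rfl⟩
  | cons x p ih =>
    obtain ⟨i', h⟩ := ih (r x i)
    exact ⟨i', by simp [mdel, h]⟩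

theorem mdelW_split (s : List A) (p q : List Q) :
    ∃ s', mdelW d r s (p ++ q) = mdelW d r s p ++ mdelW d r s' q := by
  induction s generalizing p q with
  | nil => exact ⟨[], rfl⟩
  | cons i s ih =>
    obtain ⟨i', h⟩ := mdel_split d r p q i
    obtain ⟨s', h'⟩ := ih (mdel d r i p) (mdel d r i' q)
    exact ⟨i' :: s', by simp [mdelW, h, h']⟩

theorem mdelW_lift (hr : MInvertible r) (s' : List A) (x : Q) (q : List Q) :
    ∃ s y, mdelW d r s (x :: q) = y :: mdelW d r s' q := by
  induction s' generalizing x q with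
  | nil => exact ⟨[], x, rfl⟩
  | cons i' s' ih =>
    obtain ⟨i, hi⟩ := (hr x).2 i'
    obtain ⟨s, y, h⟩ := ih (d i x) (mdel d r i' q)
    exact ⟨i :: s, y, by simp [mdelW, mdel, hi, h]⟩

theorem mdel_inj (hd : MReversible d) (i : A) (u v : List Q)
    (h : mdel d r i u = mdel d r i v) : u = v := by
  induction u generalizing i v with
  | nil => cases v with
    | nil => rfl
    | cons y v => simp [mdel] at h
  | cons x u ih => cases v with
    | nil => simp [mdel] at h
    | cons y v =>
      simp only [mdel, List.cons.injEq] at h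
      have hxy := (hd i).1 h.1
      subst hxy
      rw [ih _ _ h.2]

theorem mOrbit_refl (u : List Q) : u ∈ mOrbit d r u := ⟨[], rfl⟩

theorem mOrbit_trans {u v w : List Q} (h : v ∈ mOrbit d r u) (h' : w ∈ mOrbit d r v) :
    w ∈ mOrbit d r u := by
  obtain ⟨s, rfl⟩ := h
  obtain ⟨s', rfl⟩ := h'
  exact ⟨s ++ s', mdelW_app d r s s' u⟩

theorem mOrbit_len {u v : List Q} (h : v ∈ mOrbit d r u) : v.length = u.length := by
  obtain ⟨s, rfl⟩ := h
  exact mdelW_len d r s u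

theorem mdel_iter (i : A) (m : ℕ) (u : List Q) : (mdel d r i)^[m] u ∈ mOrbit d r u := by
  induction m generalizing u with
  | zero => exact mOrbit_refl d r u
  | succ k ih =>
    rw [Function.iterate_succ_apply]
    exact mOrbit_trans d r ⟨[i], rfl⟩ (ih _)

theorem mOrbit_symm [Finite Q] (hd : MReversible d) {u v : List Q} (h : v ∈ mOrbit d r u) :
    u ∈ mOrbit d r v := by
  obtain ⟨s, rfl⟩ := h
  induction s generalizing u with
  | nil => exact mOrbit_refl d r _
  | cons i s ih =>
    refine mOrbit_trans d r (ih (u := mdel d r i u)) ?_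
    obtain ⟨m, hm⟩ := aux_period {l : List Q | l.length = u.length}
      (List.finite_length_eq Q u.length) (mdel d r i)
      (fun l hl => by simpa [mdel_len] using hl)
      (fun a _ b _ hab => mdel_inj d r hd i a b hab) u rfl
    have := mdel_iter d r i m (mdel d r i u)
    rwa [hm] at this

theorem mOrbit_eq [Finite Q] (hd : MReversible d) {u v : List Q} (h : v ∈ mOrbit d r u) :
    mOrbit d r v = mOrbit d r u := by
  ext w
  exact ⟨fun hw => mOrbit_trans d r h hw,
    fun hw => mOrbit_trans d r (mOrbit_symm d r hd h) hw⟩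

theorem mOrbit_finite [Finite Q] (u : List Q) : (mOrbit d r u).Finite :=
  (List.finite_length_eq Q u.length).subset (fun _ hv => mOrbit_len d r hv)

theorem mOrbit_suffix {p f v : List Q} (h : v ∈ mOrbit d r (p ++ f)) :
    ∃ p' f', v = p' ++ f' ∧ p' ∈ mOrbit d r p ∧ f' ∈ mOrbit d r f := by
  obtain ⟨s, rfl⟩ := h
  obtain ⟨s', h⟩ := mdelW_split d r s p f
  exact ⟨_, _, h, ⟨s, rfl⟩, ⟨s', rfl⟩⟩

/-- all length-n factors are stems -/
def JF (t l : List Q) : Prop :=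
  ∀ p f q : List Q, l = p ++ f ++ q → f.length = t.length → f ∈ mOrbit d r t

theorem JF_of (t l : List Q) (hl : t.length ≤ l.length) (h : IsJWord d r t l) :
    JF d r t l := by
  rintro p f q rfl hf
  by_cases hp : p = []
  · subst hp
    have := h.1 t.length hl le_rfl
    rw [List.take_length] at this
    simpa [← hf] using this
  · have hp' : 0 < p.length := List.length_pos_iff.2 hp
    have h2 := h.2 (p.length - 1 + t.length) (by omega) (by simp; omega)
    have e : (p ++ f ++ q).take (p.length - 1 + t.length + 1) = p ++ f := by
      have : p.length - 1 + t.length + 1 = (p ++ f).length := by simp; omega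
      rw [this, List.take_left]
    rw [e] at h2
    obtain ⟨v', hv', hs⟩ := h2 _ (mOrbit_refl d r _)
    have : v' = f := by
      obtain ⟨z, hz⟩ := hs
      exact (List.append_inj' hz (by rw [mOrbit_len d r hv', hf])).2
    rwa [← this]

theorem of_JF (t l : List Q) (hl : t.length ≤ l.length) (h : JF d r t l) :
    IsJWord d r t l := by
  constructor
  · intro i _ hit
    have h0 := h [] (l.take t.length) (l.drop t.length) (by simp) (by simp [hl])
    have e : l.take i = (l.take t.length).take i := by
      rw [List.take_take, min_eq_left hit]
    rw [e]
    have e2 : t = t.take i ++ t.drop i := by simp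
    rw [e2] at h0
    obtain ⟨p', f', he, hp', _⟩ := mOrbit_suffix d r h0
    have hlen := mOrbit_len d r hp'
    rw [← e2] at he
    rw [he]
    have : p'.length = i := by rw [hlen]; simp [hit]
    rw [← this, List.take_left, this]
    exact hp'
  · intro k hk hkl v hv
    have e : l.take (k+1) = l.take (k+1-t.length) ++ (l.take (k+1)).drop (k+1-t.length) := by
      conv_lhs => rw [← List.take_append_drop (k+1-t.length) (l.take (k+1))]
      rw [List.take_take, min_eq_left (by omega)]
    have hf := h (l.take (k+1-t.length)) ((l.take (k+1)).drop (k+1-t.length)) (l.drop (k+1))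
      (by rw [← e]; simp) (by simp; omega)
    rw [e] at hv
    obtain ⟨p', f', he, _, hf'⟩ := mOrbit_suffix d r hv
    exact ⟨f', mOrbit_trans d r hf hf', ⟨p', he.symm⟩⟩

theorem JF_glue (t l a m : List Q) (ha : a.length = t.length)
    (h1 : JF d r t (l ++ a)) (h2 : JF d r t (a ++ m)) : JF d r t (l ++ a ++ m) := by
  intro p f q he hf
  have hlen := congrArg List.length he
  simp only [List.length_append] at hlen
  by_cases hp : p.length ≤ l.length
  · have : p ++ f <+: l ++ a :=
      List.prefix_of_prefix_length_le (l₃ := l ++ a ++ m) ⟨q, he.symm⟩ ⟨m, rfl⟩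
        (by simp only [List.length_append]; omega)
    obtain ⟨q', hq'⟩ := this
    exact h1 p f q' hq'.symm hf
  · have : f ++ q <:+ a ++ m :=
      List.suffix_of_suffix_length_le (l₃ := l ++ a ++ m) ⟨p, by simp [he]⟩ ⟨l, by simp⟩
        (by simp only [List.length_append]; omega)
    obtain ⟨p', hp'⟩ := this
    exact h2 p' f q (by simp [← hp']) hf

theorem JF_infix (t l p f q : List Q) (h : JF d r t l) (he : l = p ++ f ++ q) :
    JF d r t f := by
  intro p' f' q' he' hf
  exact h (p ++ p') f' (q' ++ q) (by simp [he, he']) hf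

/-- reachability -/
def JR (t a b : List Q) : Prop :=
  ∃ z p : List Q, JF d r t (a ++ z) ∧ a ++ z = p ++ b

theorem JR_trans (t a b c : List Q) (hb : b.length = t.length)
    (h1 : JR d r t a b) (h2 : JR d r t b c) : JR d r t a c := by
  obtain ⟨z, p, hj, he⟩ := h1
  obtain ⟨z', p', hj', he'⟩ := h2
  refine ⟨z ++ z', p ++ p', ?_, ?_⟩
  · rw [← List.append_assoc, he]
    rw [he] at hj
    exact JF_glue d r t p b z' hb hj hj'
  · rw [← List.append_assoc, he, List.append_assoc, he', List.append_assoc]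

theorem JF_self (t a : List Q) (ha : a ∈ mOrbit d r t) : JF d r t a := by
  intro p f q he hf
  have hl := mOrbit_len d r ha
  have hlen := congrArg List.length he
  simp only [List.length_append] at hlen
  have hp : p = [] := List.length_eq_zero_iff.1 (by omega)
  have hq : q = [] := List.length_eq_zero_iff.1 (by omega)
  subst hp hq
  simp at he
  rwa [← he]

theorem JF_step (t a b : List Q) (x y : Q) (ha : a ∈ mOrbit d r t) (hb : b ∈ mOrbit d r t)
    (h : a ++ [y] = x :: b) : JF d r t (a ++ [y]) := by
  intro p f q he hf
  have hl := mOrbit_len d r ha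
  have hlen := congrArg List.length he
  simp only [List.length_append, List.length_singleton] at hlen
  by_cases hp : p = []
  · subst hp
    have : f = a := (List.append_inj (s₁ := f) (s₂ := a) he.symm (by omega)).1
    rwa [this]
  · have hp' : 0 < p.length := List.length_pos_iff.2 hp
    have hq : q = [] := List.length_eq_zero_iff.1 (by omega)
    subst hq
    rw [h] at he
    have := List.append_inj' (s₁ := [x]) (t₁ := b) (s₂ := p) (t₂ := f) (by simpa using he)
      (by rw [hf, mOrbit_len d r hb])
    rw [← this.2]; exact hb

theorem JR_step (t a b : List Q) (x y : Q) (ha : a ∈ mOrbit d r t) (hb : b ∈ mOrbit d r t)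
    (h : a ++ [y] = x :: b) : JR d r t a b :=
  ⟨[y], [x], JF_step d r t a b x y ha hb h, h⟩

theorem JR_refl (t a : List Q) (ha : a ∈ mOrbit d r t) : JR d r t a a :=
  ⟨[], [], by simpa using JF_self d r t a ha, by simp⟩

theorem JR_back [Finite Q] (hd : MReversible d) (hr : MInvertible r) (t : List Q)
    (ht : IsJungleTrunk d r t) (a b : List Q) (x y : Q)
    (ha : a ∈ mOrbit d r t) (hb : b ∈ mOrbit d r t)
    (h : a ++ [y] = x :: b) : JR d r t b a := by
  have hpre : List.dropLast '' mOrbit d r (a ++ [y]) = mOrbit d r t := by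
    ext c
    constructor
    · rintro ⟨w, hw, rfl⟩
      obtain ⟨p', f', rfl, hp', hf'⟩ := mOrbit_suffix d r hw
      have hl := mOrbit_len d r hf'
      obtain ⟨z, rfl⟩ := List.length_eq_one_iff.1 hl
      simpa using mOrbit_trans d r ha hp'
    · intro hc
      obtain ⟨s, rfl⟩ := mOrbit_trans d r (mOrbit_symm d r hd ha) hc
      refine ⟨mdelW d r s (a ++ [y]), ⟨s, rfl⟩, ?_⟩
      obtain ⟨s', h'⟩ := mdelW_split d r s a [y]
      obtain ⟨z, hz⟩ := List.length_eq_one_iff.1 (mdelW_len d r s' [y])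
      rw [h', hz]; simp
  have hsuf : List.tail '' mOrbit d r (a ++ [y]) = mOrbit d r t := by
    rw [h]
    ext c
    constructor
    · rintro ⟨w, hw, rfl⟩
      obtain ⟨p', f', rfl, hp', hf'⟩ := mOrbit_suffix d r (p := [x]) (f := b) hw
      obtain ⟨z, rfl⟩ := List.length_eq_one_iff.1 (mOrbit_len d r hp')
      simpa using mOrbit_trans d r hb hf'
    · intro hc
      obtain ⟨s', rfl⟩ := mOrbit_trans d r (mOrbit_symm d r hd hb) hc
      obtain ⟨s, z, hs⟩ := mdelW_lift d r hr s' x b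
      exact ⟨_, ⟨s, rfl⟩, by rw [hs]; rfl⟩
  have hcard : (mOrbit d r (a ++ [y])).ncard = (mOrbit d r t).ncard := by
    obtain ⟨s, hs⟩ := mOrbit_symm d r hd ha
    obtain ⟨s', h'⟩ := mdelW_split d r s a [y]
    obtain ⟨z, hz⟩ := List.length_eq_one_iff.1 (mdelW_len d r s' [y])
    rw [hs, hz] at h'
    have hmem : t ++ [z] ∈ mOrbit d r (a ++ [y]) := ⟨s, h'⟩
    rw [← mOrbit_eq d r hd hmem]
    apply ht.2.2.2
    intro v hv
    have hv' := mOrbit_trans d r hmem hv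
    refine ⟨v.tail, ?_, List.tail_suffix v⟩
    rw [← hsuf]
    exact ⟨v, hv', rfl⟩
  have hfin := mOrbit_finite d r (a ++ [y])
  have ipre : Set.InjOn List.dropLast (mOrbit d r (a ++ [y])) :=
    (Set.ncard_image_iff hfin).1 (by rw [hpre, hcard])
  have isuf : Set.InjOn List.tail (mOrbit d r (a ++ [y])) :=
    (Set.ncard_image_iff hfin).1 (by rw [hsuf, hcard])
  have hex : ∀ c : List Q, ∃ w, c ∈ mOrbit d r t → w ∈ mOrbit d r (a ++ [y]) ∧ w.dropLast = c := by
    intro c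
    by_cases hc : c ∈ mOrbit d r t
    · have hc' := hc
      rw [← hpre] at hc'
      obtain ⟨w, hw, hwc⟩ := hc'
      exact ⟨w, fun _ => ⟨hw, hwc⟩⟩
    · exact ⟨[], fun h => absurd h hc⟩
  choose g hg using hex
  have hmaps : Set.MapsTo (fun c => (g c).tail) (mOrbit d r t) (mOrbit d r t) := by
    intro c hc
    show (g c).tail ∈ _
    rw [← hsuf]
    exact ⟨g c, (hg c hc).1, rfl⟩
  have hstep : ∀ c ∈ mOrbit d r t, JR d r t c (g c).tail := by
    intro c hc
    obtain ⟨hw, hwc⟩ := hg c hc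
    have hl := mOrbit_len d r hw
    have hne : g c ≠ [] := by
      intro h0; rw [h0] at hl; simp at hl
    refine JR_step d r t c _ ((g c).head hne) ((g c).getLast hne) hc (hmaps hc) ?_
    rw [List.cons_head_tail]
    have e := List.dropLast_append_getLast hne
    rw [hwc] at e
    exact e
  have hga : (g a).tail = b := by
    have : g a = a ++ [y] :=
      ipre (hg a ha).1 (mOrbit_refl d r _) (by rw [(hg a ha).2]; simp)
    rw [this, h]; rfl
  obtain ⟨m, hm⟩ := aux_period (mOrbit d r t) (mOrbit_finite d r t) (fun c => (g c).tail) hmaps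
    (by
      intro c hc c' hc' he
      have := isuf (hg c hc).1 (hg c' hc').1 he
      rw [← (hg c hc).2, this, (hg c' hc').2]) a ha
  have hiter : ∀ m : ℕ, ∀ c ∈ mOrbit d r t, JR d r t c ((fun c => (g c).tail)^[m] c) := by
    intro m
    induction m with
    | zero => intro c hc; exact JR_refl d r t c hc
    | succ k ih =>
      intro c hc
      rw [Function.iterate_succ_apply]
      exact JR_trans d r t _ _ _ (mOrbit_len d r (hmaps hc)) (hstep c hc) (ih _ (hmaps hc))
  have := hiter m b hb
  simp only [hga] at hm
  rwa [hm] at this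

theorem JR_symm [Finite Q] (hd : MReversible d) (hr : MInvertible r) (t : List Q)
    (ht : IsJungleTrunk d r t) (z : List Q) : ∀ (a b p : List Q)
    (_ : a.length = t.length) (_ : b.length = t.length)
    (_ : JF d r t (a ++ z)) (_ : a ++ z = p ++ b), JR d r t b a := by
  induction z with
  | nil =>
    intro a b p ha hb hj he
    have hlen := congrArg List.length he
    simp only [List.length_append, List.length_nil] at hlen
    have hp : p = [] := List.length_eq_zero_iff.1 (by omega)
    subst hp
    simp at he
    subst he
    exact JR_refl d r t a (hj [] a [] (by simp) ha)
  | cons y z ih =>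
    intro a b p ha hb hj he
    have hao := hj [] a (y :: z) (by simp) ha
    have hne : a ≠ [] := by
      intro h0; subst h0; exact ht.1 (List.length_eq_zero_iff.1 ha.symm)
    obtain ⟨x, a', rfl⟩ := List.exists_cons_of_ne_nil hne
    have hlen := congrArg List.length he
    simp only [List.length_append, List.length_cons] at hlen ha
    have hco : a' ++ [y] ∈ mOrbit d r t := hj [x] (a' ++ [y]) z (by simp) (by simp [ha])
    have hpne : p ≠ [] := by
      intro h0; subst h0; simp at hlen; omega
    obtain ⟨x', p', rfl⟩ := List.exists_cons_of_ne_nil hpne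
    have he' : (a' ++ [y]) ++ z = p' ++ b := by
      simp at he; simp [he.2]
    have h1 := ih (a' ++ [y]) b p' (by simp [ha]) hb
      (JF_infix d r t _ [x] _ [] hj (by simp)) he'
    have h2 := JR_back d r hd hr t ht (x :: a') (a' ++ [y]) x y hao hco (by simp)
    exact JR_trans d r t _ _ _ (by simp [ha]) h1 h2

theorem JF_ext [Finite Q] (hd : MReversible d) (t : List Q)
    (ht : IsJungleTrunk d r t) (k : ℕ) (l : List Q) (hl : t.length ≤ l.length)
    (hj : JF d r t l) : ∃ z : List Q, z.length = k ∧ JF d r t (l ++ z) := by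
  induction k with
  | zero => exact ⟨[], rfl, by simpa using hj⟩
  | succ k ih =>
    obtain ⟨z, hz, hjz⟩ := ih
    obtain ⟨p, b, he, hb⟩ : ∃ p b, l ++ z = p ++ b ∧ b.length = t.length :=
      ⟨(l ++ z).take ((l ++ z).length - t.length), (l ++ z).drop ((l ++ z).length - t.length),
        by simp, by simp; omega⟩
    have hbo := hjz p b [] (by simp [he]) hb
    obtain ⟨x, _, _, hx, _⟩ := ht.2.2.1
    obtain ⟨s, hs⟩ := hbo
    obtain ⟨s', h'⟩ := mdelW_split d r s t [x]
    obtain ⟨y, hy⟩ := List.length_eq_one_iff.1 (mdelW_len d r s' [x])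
    rw [hs, hy] at h'
    obtain ⟨c, hc, q, hq⟩ := hx (b ++ [y]) ⟨s, h'⟩
    have hlen := congrArg List.length hq
    simp only [List.length_append, List.length_singleton, mOrbit_len d r hc] at hlen
    obtain ⟨w, rfl⟩ := List.length_eq_one_iff.1 (show q.length = 1 by omega)
    have hstep := JF_step d r t b c w y ⟨s, hs⟩ hc (by simp [← hq])
    refine ⟨z ++ [y], by simp [hz], ?_⟩
    rw [← List.append_assoc, he]
    rw [he] at hjz
    exact JF_glue d r t p b [y] hb hjz hstep

theorem JW_long [Finite Q] (hd : MReversible d) (hr : MInvertible r) (t : List Q)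
    (ht : IsJungleTrunk d r t) (s u v : List Q) (hl : t.length ≤ (s ++ u ++ v).length)
    (hj : JF d r t (s ++ u ++ v)) :
    ∃ w, IsJWord d r t (s ++ u ++ v ++ w ++ u) := by
  obtain ⟨W, hW⟩ : ∃ W, W = s ++ u ++ v := ⟨_, rfl⟩
  rw [← hW] at hj hl
  obtain ⟨b, hbl, hjb⟩ := JF_ext d r hd t ht t.length W hl hj
  obtain ⟨a, m, hWa, hal⟩ : ∃ a m, W = a ++ m ∧ a.length = t.length :=
    ⟨W.take t.length, W.drop t.length, by simp, by simp [hl]⟩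
  have hR : JR d r t b a := JR_symm d r hd hr t ht (m ++ b) a b W hal hbl
    (by rw [← List.append_assoc, ← hWa]; exact hjb) (by rw [← List.append_assoc, ← hWa])
  obtain ⟨z, p, hjz, he⟩ := hR
  have h1 : JF d r t (W ++ b ++ z) := JF_glue d r t W b z hbl hjb hjz
  rw [List.append_assoc, he, ← List.append_assoc] at h1
  rw [hWa] at hj
  have h2 := JF_glue d r t (W ++ p) a m hal h1 hj
  rw [List.append_assoc, ← hWa] at h2
  refine ⟨p ++ s, of_JF d r t _ ?_ ?_⟩
  · rw [← hW]; simp only [List.length_append]; omega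
  · exact JF_infix d r t _ [] _ v h2 (by simp [hW])

end

theorem statement11 [Fintype Q] [Fintype A] [Nonempty Q] [Nonempty A]
    (d : A → Q → Q) (r : Q → A → A)
    (hbi : MBireversible d r) (hconn : MConnected d r)
    (hnab : ¬ HasActiveSelfLiftableBranch d r)
    (t : List Q) (ht : IsJungleTrunk d r t)
    (s u v : List Q) (h : IsJWord d r t (s ++ u ++ v)) :
    ∃ w : List Q, IsJWord d r t (s ++ u ++ v ++ w ++ u) := by
  obtain ⟨hr, hd, _⟩ := hbi
  by_cases hl : t.length ≤ (s ++ u ++ v).length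
  · exact JW_long d r hd hr t ht s u v hl (JF_of d r t _ hl h)
  · have h1 := h.1 (s ++ u ++ v).length le_rfl (by omega)
    rw [List.take_length] at h1
    obtain ⟨g, hg⟩ := h1
    obtain ⟨g', h'⟩ := mdelW_split d r g (t.take (s ++ u ++ v).length)
      (t.drop (s ++ u ++ v).length)
    rw [hg, List.take_append_drop] at h'
    obtain ⟨z, hz⟩ : ∃ z, z = mdelW d r g' (t.drop (s ++ u ++ v).length) := ⟨_, rfl⟩
    rw [← hz] at h'
    have hmem : s ++ u ++ (v ++ z) ∈ mOrbit d r t := ⟨g, by rw [h']; simp⟩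
    obtain ⟨w, hw⟩ := JW_long d r hd hr t ht s u (v ++ z) (mOrbit_len d r hmem).ge
      (JF_self d r t _ hmem)
    exact ⟨z ++ w, by simpa using hw⟩
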